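/- (Theorem 4.) Let p₁,…,p_k be events in ℝ × ℝⁿ, no two lightlike separated, with separation graph G. Let χ_G ∈ ℤ[t] be the polynomial satisfying χ_G(m) = (number of proper colorings of G with m colors) for every positive integer m, and write χ_G(t) = t^k - a₁ t^{k-1} + a₂ t^{k-2} - ⋯ + (-1)^{k-1} a_{k-1} t, setting a_i = 0 for i ≥ k. Then O(p₁,…,p_k) ≤ 1 + a₁ + a₂ + ⋯ + a_n. -/

import Mathlib

open scoped InnerProductSpace

noncomputable section

/-- The observed time of the event `(t i, x i)` in the frame with velocity `v`. -/
def obsTime {n k : ℕ} (t : Fin k → ℝ) (x : Fin k → EuclideanSpace ℝ (Fin n))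
    (v : EuclideanSpace ℝ (Fin n)) (i : Fin k) : ℝ :=
  t i - ⟪x i, v⟫_ℝ

/-- A permutation `π` is an achievable order of the events `(t i, x i)`. -/
def Achievable {n k : ℕ} (t : Fin k → ℝ) (x : Fin k → EuclideanSpace ℝ (Fin n))
    (π : Equiv.Perm (Fin k)) : Prop :=
  ∃ v : EuclideanSpace ℝ (Fin n), ‖v‖ < 1 ∧
    StrictMono fun m : Fin k => obsTime t x v (π m)

/-- The events `p i` and `p j` are spacelike separated; i.e. `{i, j}` is an
edge of the separation graph `G`. -/
def SpacelikeSep {n k : ℕ} (t : Fin k → ℝ) (x : Fin k → EuclideanSpace ℝ (Fin n))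
    (i j : Fin k) : Prop :=
  (t i - t j) ^ 2 < ‖x i - x j‖ ^ 2

/-- A proper coloring of the separation graph with colors in `Fin m`:
spacelike separated (i.e. adjacent) events receive different colors. -/
def ProperColoring {n k : ℕ} (t : Fin k → ℝ) (x : Fin k → EuclideanSpace ℝ (Fin n))
    (m : ℕ) (c : Fin k → Fin m) : Prop :=
  ∀ i j : Fin k, i ≠ j → SpacelikeSep t x i j → c i ≠ c j

open Classical in
/-- identify vertex `w` with vertex `u`. -/
def mergeV {V : Type} (u w y : V) : V := if y = w then u else y

/-- contraction of an edge list. -/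
def contractL {V : Type} (u w : V) (L : List (V × V)) : List (V × V) :=
  L.map fun e => (mergeV u w e.1, mergeV u w e.2)

open Classical in
/-- unsigned coefficients of the chromatic polynomial, by deletion-contraction. -/
def whit {V : Type} : List (V × V) → ℕ → ℕ
  | [], 0 => 1
  | [], _ + 1 => 0
  | e :: L, 0 => if e.1 = e.2 then 0 else whit L 0
  | e :: L, i + 1 => if e.1 = e.2 then 0 else whit L (i + 1) + whit (contractL e.1 e.2 L) i
termination_by L => L.length
decreasing_by all_goals simp [contractL]

lemma whit_zero_le {V : Type} (L : List (V × V)) : whit L 0 ≤ 1 := by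
  induction L with
  | nil => simp [whit]
  | cons e L ih => rw [whit]; split_ifs <;> omega

open Classical in
lemma whit_vanish {V : Type} (N : ℕ) : ∀ (L : List (V × V)), L.length = N → ∀ (S : Finset V)
    (i : ℕ), (∀ e ∈ L, e.1 ∈ S ∧ e.2 ∈ S) → 1 ≤ i → S.card ≤ i → whit L i = 0 := by
  induction N with
  | zero =>
    intro L hL S i _ hi _
    obtain rfl := List.length_eq_zero_iff.1 hL
    obtain ⟨j, rfl⟩ : ∃ j, i = j + 1 := ⟨i - 1, by omega⟩
    simp [whit]
  | succ N ih =>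
    intro L hL S i hS hi hc
    obtain ⟨e, L, rfl⟩ := List.exists_cons_of_length_eq_add_one hL
    obtain ⟨j, rfl⟩ : ∃ j, i = j + 1 := ⟨i - 1, by omega⟩
    have hlen : L.length = N := by simpa using hL
    rw [whit]
    split_ifs with h
    · rfl
    · have he := hS e (by simp)
      have h1 := ih L hlen S (j+1) (fun e' he' => hS e' (by simp [he'])) hi hc
      have hcard := Finset.card_erase_of_mem he.2
      have hu : e.1 ∈ S.erase e.2 := Finset.mem_erase.2 ⟨h, he.1⟩
      have hpos : 0 < (S.erase e.2).card := Finset.card_pos.2 ⟨_, hu⟩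
      have hmem : ∀ y ∈ S, mergeV e.1 e.2 y ∈ S.erase e.2 := by
        intro y hy
        unfold mergeV
        split_ifs with h'
        · exact hu
        · exact Finset.mem_erase.2 ⟨h', hy⟩
      have h2 := ih (contractL e.1 e.2 L) (by simp [contractL, hlen]) (S.erase e.2) j (by
        intro e' he'
        simp only [contractL, List.mem_map] at he'
        obtain ⟨e'', he'', rfl⟩ := he'
        have := hS e'' (by simp [he''])
        exact ⟨hmem _ this.1, hmem _ this.2⟩) (by omega) (by omega)
      omega

/-- proper colorings of an edge list. -/
def LCol {V : Type} (L : List (V × V)) (m : ℕ) (c : V → Fin m) : Prop :=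
  ∀ e ∈ L, c e.1 ≠ c e.2

lemma LCol_contract {V : Type} (L : List (V × V)) (m : ℕ) (c : V → Fin m) (u w : V) :
    LCol (contractL u w L) m c ↔ LCol L m (c ∘ mergeV u w) := by
  simp only [LCol, contractL, List.mem_map]
  constructor
  · intro h e he
    exact h _ ⟨e, he, rfl⟩
  · rintro h _ ⟨e, he, rfl⟩
    exact h e he

open Classical in
lemma card_contract {V : Type} [Fintype V] (L : List (V × V)) (m : ℕ) (u w : V) (huw : u ≠ w) :
    Nat.card {c : V → Fin m // LCol (contractL u w L) m c}
      = m * Nat.card {c : V → Fin m // LCol L m c ∧ c u = c w} := by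
  have E : {c : V → Fin m // LCol (contractL u w L) m c} ≃
      Fin m × {c : V → Fin m // LCol L m c ∧ c u = c w} :=
    { toFun := fun c => (c.1 w, ⟨c.1 ∘ mergeV u w, (LCol_contract L m c.1 u w).1 c.2, by
        simp [mergeV]⟩)
      invFun := fun p => ⟨Function.update p.2.1 w p.1, by
        rw [LCol_contract]
        have : Function.update p.2.1 w p.1 ∘ mergeV u w = p.2.1 := by
          funext y
          by_cases hy : y = w
          · simp [mergeV, hy, huw, p.2.2.2]
          · simp [mergeV, hy]
        rw [this]
        exact p.2.2.1⟩
      left_inv := by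
        rintro ⟨c, hc⟩
        ext1
        funext y
        by_cases hy : y = w
        · simp [hy]
        · simp [mergeV, hy]
      right_inv := by
        rintro ⟨a, c, hc, hcu⟩
        ext1
        · simp
        · ext1
          funext y
          by_cases hy : y = w
          · simp [mergeV, hy, huw, hcu]
          · simp [mergeV, hy] }
  rw [Nat.card_congr E, Nat.card_prod, Nat.card_fin]

open Classical in
lemma card_split {V : Type} [Fintype V] (L : List (V × V)) (m : ℕ) (e : V × V) :
    Nat.card {c : V → Fin m // LCol L m c}
      = Nat.card {c : V → Fin m // LCol (e :: L) m c}
        + Nat.card {c : V → Fin m // LCol L m c ∧ c e.1 = c e.2} := by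
  simp only [Nat.card_eq_fintype_card, Fintype.card_subtype]
  rw [← Finset.card_filter_add_card_filter_not (s := Finset.univ.filter (LCol L m))
    (fun c => c e.1 ≠ c e.2), Finset.filter_filter, Finset.filter_filter]
  congr 2
  · ext c; simp [LCol, and_comm]
  · ext c; simp

open Classical in
lemma card_col {V : Type} [Fintype V] (m : ℕ) (hm : 0 < m) (l : ℕ) :
    ∀ (L : List (V × V)), L.length = l → ∀ N, l ≤ N →
    (Nat.card {c : V → Fin m // LCol L m c} : ℚ) = (m : ℚ) ^ (Fintype.card V) *
      ∑ i ∈ Finset.range (N + 1), (-1) ^ i * (whit L i : ℚ) * ((m : ℚ)⁻¹) ^ i := by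
  have hm' : (m : ℚ) ≠ 0 := by positivity
  induction l with
  | zero =>
    intro L hL N _
    obtain rfl := List.length_eq_zero_iff.1 hL
    rw [Finset.sum_range_succ']
    simp [whit, LCol]
  | succ l ih =>
    intro L hL N hN
    obtain ⟨e, L, rfl⟩ := List.exists_cons_of_length_eq_add_one hL
    have hlen : L.length = l := by simpa using hL
    by_cases h : e.1 = e.2
    · have h0 : ∀ i, whit (e :: L) i = 0 := by
        intro i; cases i <;> simp [whit, h]
      have : IsEmpty {c : V → Fin m // LCol (e :: L) m c} :=
        ⟨fun c => c.2 e (by simp) (by rw [h])⟩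
      simp [h0]
    · obtain ⟨M, rfl⟩ : ∃ M, N = M + 1 := ⟨N - 1, by omega⟩
      have h1 := ih L hlen (M + 1) (by omega)
      have h2 := ih (contractL e.1 e.2 L) (by simp [contractL, hlen]) M (by omega)
      have h3 := card_split L m e
      have h4 := card_contract L m e.1 e.2 h
      rw [h4] at h2
      rw [h3] at h1
      push_cast at h1 h2
      have h5 : (Nat.card {c : V → Fin m // LCol L m c ∧ c e.1 = c e.2} : ℚ) =
          (m:ℚ)⁻¹ * ((m : ℚ) ^ (Fintype.card V) *
      ∑ i ∈ Finset.range (M + 1), (-1) ^ i * (whit (contractL e.1 e.2 L) i : ℚ) *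
        ((m : ℚ)⁻¹) ^ i) := by
        rw [← h2]; field_simp
      rw [Finset.sum_range_succ'] at h1 ⊢
      have h6 : ∑ i ∈ Finset.range (M + 1), (-1) ^ (i+1) * (whit (e :: L) (i+1) : ℚ) *
          ((m : ℚ)⁻¹) ^ (i+1) =
          ∑ i ∈ Finset.range (M + 1), (-1) ^ (i+1) * (whit L (i+1) : ℚ) * ((m : ℚ)⁻¹) ^ (i+1)
          - (m:ℚ)⁻¹ * ∑ i ∈ Finset.range (M + 1), (-1) ^ i *
            (whit (contractL e.1 e.2 L) i : ℚ) * ((m : ℚ)⁻¹) ^ i := by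
        rw [Finset.mul_sum, ← Finset.sum_sub_distrib]
        refine Finset.sum_congr rfl fun i _ => ?_
        rw [whit, if_neg h]
        push_cast
        ring
      have h7 : whit (e :: L) 0 = whit L 0 := by rw [whit, if_neg h]
      rw [h6, h7]
      linear_combination h1 - h5

lemma card_col_int {V : Type} [Fintype V] (m : ℕ) (hm : 0 < m) (L : List (V × V)) :
    (Nat.card {c : V → Fin m // LCol L m c} : ℤ) =
      ∑ i ∈ Finset.range (Fintype.card V + 1),
        (-1) ^ i * (whit L i : ℤ) * (m : ℤ) ^ (Fintype.card V - i) := by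
  have hm' : (m : ℚ) ≠ 0 := by positivity
  have h := card_col (V := V) m hm L.length L rfl (max L.length (Fintype.card V)) (le_max_left _ _)
  have hsub : ∑ i ∈ Finset.range (max L.length (Fintype.card V) + 1),
      (-1) ^ i * (whit L i : ℚ) * ((m : ℚ)⁻¹) ^ i =
      ∑ i ∈ Finset.range (Fintype.card V + 1), (-1) ^ i * (whit L i : ℚ) * ((m : ℚ)⁻¹) ^ i := by
    symm
    apply Finset.sum_subset
    · intro i; simp only [Finset.mem_range]; omega
    · intro i _ hi
      simp only [Finset.mem_range, not_lt] at hi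
      rw [whit_vanish L.length L rfl Finset.univ i (by simp) (by omega)
        (by rw [Finset.card_univ]; omega)]
      simp
  rw [hsub, Finset.mul_sum] at h
  have : ((Nat.card {c : V → Fin m // LCol L m c} : ℤ) : ℚ) =
      ((∑ i ∈ Finset.range (Fintype.card V + 1),
        (-1) ^ i * (whit L i : ℤ) * (m : ℤ) ^ (Fintype.card V - i) : ℤ) : ℚ) := by
    push_cast
    rw [h]
    refine Finset.sum_congr rfl fun i hi => ?_
    have hi' : i ≤ Fintype.card V := by simp only [Finset.mem_range] at hi; omega
    rw [pow_sub₀ _ hm' hi', inv_pow]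
    ring
  exact_mod_cast this

section regions

variable {E V : Type} [AddCommGroup E] [Module ℝ E]

open Classical in
/-- sign list of a point. -/
def sgnL (f : V → E → ℝ) (L : List (V × V)) (v : E) : List Bool :=
  L.map fun e => decide (f e.1 v < f e.2 v)

/-- sign lists realised by regions of the arrangement inside `K`. -/
def regs (f : V → E → ℝ) (L : List (V × V)) (K : Set E) : Set (List Bool) :=
  sgnL f L '' {v | v ∈ K ∧ ∀ e ∈ L, f e.1 v ≠ f e.2 v}

lemma regs_finite (f : V → E → ℝ) (L : List (V × V)) (K : Set E) : (regs f L K).Finite := by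
  apply (List.finite_length_eq Bool L.length).subset
  rintro _ ⟨v, _, rfl⟩
  simp [sgnL]

lemma regs_step [FiniteDimensional ℝ E] (c : V → ℝ) (g : V → E →ₗ[ℝ] ℝ)
    (e : V × V) (L : List (V × V)) (K : Set E) (hK : Convex ℝ K) :
    (regs (fun i v => c i - g i v) (e :: L) K).ncard
        ≤ (regs (fun i v => c i - g i v) L K).ncard ∨
    ∃ K' : Set E, Convex ℝ K' ∧
      Module.finrank ℝ (vectorSpan ℝ K') < Module.finrank ℝ (vectorSpan ℝ K) ∧
      (regs (fun i v => c i - g i v) (e :: L) K).ncard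
        ≤ (regs (fun i v => c i - g i v) L K).ncard +
          (regs (fun i v => c i - g i v) (contractL e.1 e.2 L) K').ncard := by
  set f : V → E → ℝ := fun i v => c i - g i v with hf
  set T : Set (List Bool) := {s | true :: s ∈ regs f (e :: L) K} with hT
  set F : Set (List Bool) := {s | false :: s ∈ regs f (e :: L) K} with hF
  have hTL : T ⊆ regs f L K := by
    rintro s ⟨v, ⟨hv, hne⟩, hs⟩
    simp only [sgnL, List.map_cons, List.cons.injEq] at hs
    exact ⟨v, ⟨hv, fun e' he' => hne e' (by simp [he'])⟩, hs.2⟩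
  have hFL : F ⊆ regs f L K := by
    rintro s ⟨v, ⟨hv, hne⟩, hs⟩
    simp only [sgnL, List.map_cons, List.cons.injEq] at hs
    exact ⟨v, ⟨hv, fun e' he' => hne e' (by simp [he'])⟩, hs.2⟩
  have hfin := regs_finite f L K
  have hTf := hfin.subset hTL
  have hFf := hfin.subset hFL
  have hsplit : regs f (e :: L) K = (List.cons true '' T) ∪ (List.cons false '' F) := by
    ext s
    constructor
    · intro h
      have h' := h
      obtain ⟨v, hv, rfl⟩ := h'
      simp only [sgnL, List.map_cons] at h ⊢
      cases hb : decide (f e.1 v < f e.2 v)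
      · right; rw [hb] at h; exact ⟨_, h, rfl⟩
      · left; rw [hb] at h; exact ⟨_, h, rfl⟩
    · rintro (⟨s, hs, rfl⟩ | ⟨s, hs, rfl⟩)
      · exact hs
      · exact hs
  have hcard : (regs f (e :: L) K).ncard ≤ T.ncard + F.ncard := by
    rw [hsplit]
    refine (Set.ncard_union_le _ _).trans ?_
    exact Nat.add_le_add (Set.ncard_image_le hTf) (Set.ncard_image_le hFf)
  have hun := Set.ncard_union_add_ncard_inter T F hTf hFf
  have hule : (T ∪ F).ncard ≤ (regs f L K).ncard :=
    Set.ncard_le_ncard (Set.union_subset hTL hFL) hfin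
  by_cases hemp : T ∩ F = ∅
  · left
    rw [hemp, Set.ncard_empty] at hun
    omega
  right
  have key : ∀ s ∈ T ∩ F, ∃ v ∈ K, ∃ w ∈ K, f e.1 v < f e.2 v ∧ f e.2 w < f e.1 w ∧
      (∀ e' ∈ L, f e'.1 v ≠ f e'.2 v) ∧ (∀ e' ∈ L, f e'.1 w ≠ f e'.2 w) ∧
      sgnL f L v = s ∧ sgnL f L w = s := by
    rintro s ⟨⟨v, ⟨hv, hne⟩, hs⟩, ⟨w, ⟨hw, hne'⟩, hs'⟩⟩
    simp only [sgnL, List.map_cons, List.cons.injEq] at hs hs'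
    refine ⟨v, hv, w, hw, by simpa using hs.1, ?_, fun e' he' => hne e' (by simp [he']),
      fun e' he' => hne' e' (by simp [he']), hs.2, hs'.2⟩
    have h1 : f e.2 w ≤ f e.1 w := by simpa using hs'.1
    exact lt_of_le_of_ne h1 (hne' e (by simp)).symm
  refine ⟨K ∩ {v | f e.1 v = f e.2 v}, ?_, ?_, ?_⟩
  · refine hK.inter ?_
    intro v hv w hw α β hα hβ hαβ
    simp only [hf, Set.mem_setOf_eq, map_add, map_smul, smul_eq_mul] at hv hw ⊢
    linear_combination α * hv + β * hw + (c e.2 - c e.1) * hαβ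
  · obtain ⟨s, hs⟩ := Set.nonempty_iff_ne_empty.2 hemp
    obtain ⟨v, hv, w, hw, h1, h2, -⟩ := key s hs
    apply Submodule.finrank_lt_finrank_of_lt
    refine lt_of_le_of_ne (vectorSpan_mono ℝ Set.inter_subset_left) ?_
    intro heq
    have hmem : v -ᵥ w ∈ vectorSpan ℝ K := vsub_mem_vectorSpan ℝ hv hw
    rw [← heq] at hmem
    have hle : vectorSpan ℝ (K ∩ {v | f e.1 v = f e.2 v}) ≤ LinearMap.ker (g e.1 - g e.2) := by
      rw [vectorSpan_def, Submodule.span_le]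
      rintro _ ⟨a, ⟨_, ha⟩, b, ⟨_, hb⟩, rfl⟩
      simp only [hf, Set.mem_setOf_eq] at ha hb
      simp only [vsub_eq_sub, SetLike.mem_coe, LinearMap.mem_ker, map_sub, LinearMap.sub_apply]
      linarith
    have := hle hmem
    simp only [vsub_eq_sub, LinearMap.mem_ker, map_sub, LinearMap.sub_apply] at this
    simp only [hf] at h1 h2
    linarith
  · have hsub : T ∩ F ⊆ regs f (contractL e.1 e.2 L) (K ∩ {v | f e.1 v = f e.2 v}) := by
      intro s hs
      obtain ⟨v, hv, w, hw, h1, h2, h3, h4, h5, h6⟩ := key s hs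
      obtain ⟨α, β, hα, hβ, hαβ, hz⟩ : ∃ α β : ℝ, 0 < α ∧ 0 < β ∧ α + β = 1 ∧
          α * (f e.1 v - f e.2 v) + β * (f e.1 w - f e.2 w) = 0 := by
        set A := f e.2 v - f e.1 v with hA
        set B := f e.1 w - f e.2 w with hB
        have hA0 : 0 < A := by linarith
        have hB0 : 0 < B := by linarith
        refine ⟨B / (A + B), A / (A + B), by positivity, by positivity, by field_simp; ring, ?_⟩
        have : f e.1 v - f e.2 v = -A := by ring
        rw [this]; ring
      have hcomb : ∀ i, f i (α • v + β • w) = α * f i v + β * f i w := by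
        intro i
        simp only [hf, map_add, map_smul, smul_eq_mul]
        linear_combination (- c i) * hαβ
      have hmerge : ∀ y, f (mergeV e.1 e.2 y) (α • v + β • w) = f y (α • v + β • w) := by
        intro y
        unfold mergeV
        split_ifs with hy
        · rw [hy, hcomb, hcomb]; linarith
        · rfl
      have hsig : ∀ e' ∈ L, (f e'.1 v < f e'.2 v ↔ f e'.1 w < f e'.2 w) := by
        have : sgnL f L v = sgnL f L w := h5.trans h6.symm
        simpa [sgnL] using this
      have hdich : ∀ e' ∈ L, (f e'.1 (α • v + β • w) ≠ f e'.2 (α • v + β • w)) ∧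
          (f e'.1 (α • v + β • w) < f e'.2 (α • v + β • w) ↔ f e'.1 v < f e'.2 v) := by
        intro e' he'
        rw [hcomb, hcomb]
        rcases lt_or_gt_of_ne (h3 e' he') with h | h
        · have h' := (hsig e' he').1 h
          have := mul_lt_mul_of_pos_left h hα
          have := mul_lt_mul_of_pos_left h' hβ
          constructor
          · apply ne_of_lt; linarith
          · exact ⟨fun _ => h, fun _ => by linarith⟩
        · have h' : f e'.2 w < f e'.1 w := by
            refine lt_of_le_of_ne (not_lt.1 fun hc => ?_) (h4 e' he').symm
            exact absurd ((hsig e' he').2 hc) (not_lt.2 h.le)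
          have := mul_lt_mul_of_pos_left h hα
          have := mul_lt_mul_of_pos_left h' hβ
          constructor
          · apply ne_of_gt; linarith
          · exact ⟨fun _ => by linarith, fun _ => by linarith⟩
      refine ⟨α • v + β • w, ⟨⟨hK hv hw hα.le hβ.le hαβ, ?_⟩, ?_⟩, ?_⟩
      · simp only [Set.mem_setOf_eq]
        rw [hcomb, hcomb]; linarith
      · intro e' he'
        simp only [contractL, List.mem_map] at he'
        obtain ⟨e'', he'', rfl⟩ := he'
        simp only [hmerge]
        exact (hdich e'' he'').1
      · rw [← h5]
        simp only [sgnL, contractL, List.map_map]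
        apply List.map_congr_left
        intro e' he'
        simp only [Function.comp, hmerge]
        exact decide_eq_decide.2 (hdich e' he').2
    have := Set.ncard_le_ncard hsub (regs_finite _ _ _)
    omega

lemma regs_le [FiniteDimensional ℝ E] (c : V → ℝ) (g : V → E →ₗ[ℝ] ℝ) (l : ℕ) :
    ∀ (L : List (V × V)), L.length = l → ∀ (d : ℕ) (K : Set E), Convex ℝ K →
      Module.finrank ℝ (vectorSpan ℝ K) ≤ d →
      (regs (fun i v => c i - g i v) L K).ncard ≤ ∑ i ∈ Finset.range (d + 1), whit L i := by
  induction l with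
  | zero =>
    intro L hL d K _ _
    obtain rfl := List.length_eq_zero_iff.1 hL
    rw [Finset.sum_range_succ']
    have : regs (fun i v => c i - g i v) [] K ⊆ {[]} := by
      rintro _ ⟨v, _, rfl⟩
      simp [sgnL]
    have := Set.ncard_le_ncard this
    simp only [Set.ncard_singleton] at this
    simp [whit, this]
  | succ l ih =>
    intro L hL d K hK hd
    obtain ⟨e, L, rfl⟩ := List.exists_cons_of_length_eq_add_one hL
    have hlen : L.length = l := by simpa using hL
    by_cases h : e.1 = e.2
    · have : regs (fun i v => c i - g i v) (e :: L) K = ∅ := by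
        rw [Set.eq_empty_iff_forall_notMem]
        rintro _ ⟨v, ⟨_, hv⟩, rfl⟩
        exact hv e (by simp) (by rw [h])
      rw [this]; simp
    · have h1 := ih L hlen d K hK hd
      have hmono : ∀ i, whit L i ≤ whit (e :: L) i := by
        intro i; cases i <;> simp [whit, h]
      rcases regs_step c g e L K hK with h2 | ⟨K', hK', hlt, h2⟩
      · exact h2.trans (h1.trans (Finset.sum_le_sum fun i _ => hmono i))
      · obtain ⟨d', rfl⟩ : ∃ d', d = d' + 1 := ⟨d - 1, by omega⟩
        have h3 := ih (contractL e.1 e.2 L) (by simp [contractL, hlen]) d' K' hK' (by omega)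
        have h4 : ∑ i ∈ Finset.range (d' + 1 + 1), whit (e :: L) i =
            ∑ i ∈ Finset.range (d' + 1 + 1), whit L i +
            ∑ i ∈ Finset.range (d' + 1), whit (contractL e.1 e.2 L) i := by
          rw [Finset.sum_range_succ', Finset.sum_range_succ' (fun i => whit L i)]
          have : ∀ i, whit (e :: L) (i+1) = whit L (i+1) + whit (contractL e.1 e.2 L) i := by
            intro i; rw [whit, if_neg h]
          simp only [this, Finset.sum_add_distrib]
          rw [whit, if_neg h]
          ring
        omega

end regions

open Classical in
/-- the list of edges of the separation graph -/
def sepList {n k : ℕ} (t : Fin k → ℝ) (x : Fin k → EuclideanSpace ℝ (Fin n)) :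
    List (Fin k × Fin k) :=
  (Finset.univ.filter fun e : Fin k × Fin k => SpacelikeSep t x e.1 e.2).toList

lemma mem_sepList {n k : ℕ} (t : Fin k → ℝ) (x : Fin k → EuclideanSpace ℝ (Fin n))
    (e : Fin k × Fin k) : e ∈ sepList t x ↔ SpacelikeSep t x e.1 e.2 := by
  simp [sepList]

lemma sep_ne {n k : ℕ} {t : Fin k → ℝ} {x : Fin k → EuclideanSpace ℝ (Fin n)}
    {i j : Fin k} (h : SpacelikeSep t x i j) : i ≠ j := by
  rintro rfl
  simp [SpacelikeSep] at h

lemma not_sep_lt {n k : ℕ} {t : Fin k → ℝ} {x : Fin k → EuclideanSpace ℝ (Fin n)}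
    {i j : Fin k} (h : ¬ SpacelikeSep t x i j) (v : EuclideanSpace ℝ (Fin n)) (hv : ‖v‖ < 1) :
    obsTime t x v i < obsTime t x v j ↔ t i < t j := by
  simp only [SpacelikeSep, not_lt] at h
  have habs : ‖x i - x j‖ ≤ |t i - t j| := by
    rw [← abs_of_nonneg (norm_nonneg (x i - x j))]
    exact sq_le_sq.1 h
  have hin := abs_real_inner_le_norm (x i - x j) v
  rw [inner_sub_left] at hin
  have hin' := abs_le.1 hin
  have hn := norm_nonneg (x i - x j)
  have hvn := norm_nonneg v
  have hle : ‖x i - x j‖ * ‖v‖ ≤ |t i - t j| * ‖v‖ := mul_le_mul_of_nonneg_right habs hvn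
  simp only [obsTime]
  constructor
  · intro hlt
    by_contra hge
    rw [abs_of_nonneg (by linarith)] at hle
    nlinarith
  · intro hlt
    rw [abs_of_neg (by linarith)] at hle
    nlinarith

lemma card_achievable {n k : ℕ} (t : Fin k → ℝ) (x : Fin k → EuclideanSpace ℝ (Fin n)) :
    Nat.card {π : Equiv.Perm (Fin k) // Achievable t x π} ≤
      (regs (fun i v => t i - (innerₛₗ ℝ (x i)) v) (sepList t x) (Metric.ball 0 1)).ncard := by
  set R := regs (fun i v => t i - (innerₛₗ ℝ (x i)) v) (sepList t x) (Metric.ball 0 1) with hR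
  have hfin : R.Finite := regs_finite _ _ _
  have hinj : ∀ {v : EuclideanSpace ℝ (Fin n)} {π : Equiv.Perm (Fin k)},
      StrictMono (fun m => obsTime t x v (π m)) → Function.Injective (obsTime t x v) := by
    intro v π h i j hij
    have := h.injective (a₁ := π.symm i) (a₂ := π.symm j) (by simpa using hij)
    simpa using this
  choose v hv hmono using fun π : {π : Equiv.Perm (Fin k) // Achievable t x π} => π.2
  let F : {π : Equiv.Perm (Fin k) // Achievable t x π} → R := fun π =>
    ⟨
      sgnL (fun i v => t i - (innerₛₗ ℝ (x i)) v) (sepList t x) (v π),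
      ⟨v π, ⟨by simpa using hv π, fun e he heq =>
        sep_ne ((mem_sepList t x e).1 he) (hinj (hmono π) (by simpa [obsTime] using heq))⟩, rfl⟩⟩
  have hF : Function.Injective F := by
    intro π σ h
    have h' : ∀ i j, SpacelikeSep t x i j →
        (obsTime t x (v π) i < obsTime t x (v π) j ↔ obsTime t x (v σ) i < obsTime t x (v σ) j) := by
      have := congrArg Subtype.val h
      simp only [F, sgnL, List.map_inj_left, decide_eq_decide] at this
      intro i j hij
      simpa [obsTime] using this (i, j) ((mem_sepList t x _).2 hij)
    have h2 : ∀ i j, 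
        (obsTime t x (v π) i < obsTime t x (v π) j ↔ obsTime t x (v σ) i < obsTime t x (v σ) j) := by
      intro i j
      by_cases hs : SpacelikeSep t x i j
      · exact h' i j hs
      · rw [not_sep_lt hs _ (hv π), not_sep_lt hs _ (hv σ)]
    have h3 : StrictMono fun m => obsTime t x (v π) (σ.1 m) := fun a b hab =>
      (h2 _ _).2 (hmono σ hab)
    have h4 := (StrictMono.range_inj (hmono π) h3).1 (by
      have e1 : (fun m => obsTime t x (v π) (π.1 m)) = obsTime t x (v π) ∘ π.1 := rfl
      have e2 : (fun m => obsTime t x (v π) (σ.1 m)) = obsTime t x (v π) ∘ σ.1 := rfl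
      rw [e1, e2, π.1.surjective.range_comp, σ.1.surjective.range_comp])
    ext1
    ext1 m
    exact hinj (hmono π) (congrFun h4 m)
  have : Finite R := hfin
  rw [← Nat.card_coe_set_eq]
  exact Nat.card_le_card_of_injective F hF

/-- **Theorem 4.** Let `p₁, …, p_k` be events, no two lightlike separated, with
separation graph `G`, and let `P = χ_G ∈ ℤ[t]` be the chromatic polynomial of
`G`, written as `χ_G(t) = t^k - a₁ t^{k-1} + a₂ t^{k-2} - ⋯ + (-1)^{k-1} a_{k-1} t`
with `a_i = 0` for `i ≥ k`.  Then the number of achievable orders is at most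
`1 + a₁ + a₂ + ⋯ + a_n`. -/
theorem number_of_orders_le_chromatic_bound
    (n k : ℕ) (t : Fin k → ℝ) (x : Fin k → EuclideanSpace ℝ (Fin n))
    (hnl : ∀ i j : Fin k, i ≠ j → (t i - t j) ^ 2 ≠ ‖x i - x j‖ ^ 2)
    (P : Polynomial ℤ)
    (hP : ∀ m : ℕ, 0 < m →
      P.eval (m : ℤ) = Nat.card {c : Fin k → Fin m // ProperColoring t x m c})
    (a : ℕ → ℤ)
    (ha : ∀ i : ℕ, 1 ≤ i → i < k → P.coeff (k - i) = (-1) ^ i * a i)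
    (ha' : ∀ i : ℕ, k ≤ i → a i = 0) :
    (Nat.card {π : Equiv.Perm (Fin k) // Achievable t x π} : ℤ)
      ≤ 1 + ∑ i ∈ Finset.Icc 1 n, a i := by
  set L := sepList t x with hL
  have h1 := card_achievable t x
  have h2 := regs_le t (fun i => innerₛₗ ℝ (x i)) L.length L rfl n
    (Metric.ball (0 : EuclideanSpace ℝ (Fin n)) 1) (convex_ball _ _)
    ((Submodule.finrank_le _).trans (by simp))
  have hcol : ∀ m (c : Fin k → Fin m), ProperColoring t x m c ↔ LCol L m c := by
    intro m c
    constructor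
    · intro h e he
      have := (mem_sepList t x e).1 he
      exact h _ _ (sep_ne this) this
    · intro h i j _ hs
      exact h (i, j) ((mem_sepList t x _).2 hs)
  have hPQ : P = ∑ i ∈ Finset.range (k + 1),
      Polynomial.C ((-1) ^ i * (whit L i : ℤ)) * Polynomial.X ^ (k - i) := by
    apply Polynomial.eq_of_infinite_eval_eq
    refine Set.Infinite.mono (s := Set.range fun m : ℕ => ((m + 1 : ℕ) : ℤ)) ?_
      (Set.infinite_range_of_injective fun a b h => by simpa using h)
    rintro _ ⟨m, rfl⟩
    simp only [Set.mem_setOf_eq]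
    rw [hP (m + 1) (by omega), Nat.card_congr (Equiv.subtypeEquivRight (hcol (m + 1))),
      card_col_int (m + 1) (by omega) L, Polynomial.eval_finset_sum]
    simp
  have hai : ∀ i, 1 ≤ i → a i = whit L i := by
    intro i hi
    by_cases hik : i < k
    · have h := ha i hi hik
      rw [hPQ, Polynomial.finset_sum_coeff] at h
      simp only [Polynomial.coeff_C_mul, Polynomial.coeff_X_pow] at h
      rw [Finset.sum_eq_single i] at h
      · simp only [if_true, mul_one] at h
        have hne : ((-1 : ℤ) ^ i) ≠ 0 := by simp
        exact (mul_left_cancel₀ hne h).symm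
      · intro j hj hji
        simp only [Finset.mem_range] at hj
        rw [if_neg (by omega), mul_zero]
      · intro h'
        simp only [Finset.mem_range] at h'
        omega
    · rw [ha' i (by omega), whit_vanish L.length L rfl Finset.univ i (by simp) hi (by simp; omega)]
      simp
  have h3 : ∑ i ∈ Finset.Icc 1 n, a i = ∑ i ∈ Finset.range n, (whit L (i + 1) : ℤ) := by
    rw [Finset.range_eq_Ico, Finset.sum_Ico_add' (fun i => (whit L i : ℤ)) 0 n 1]
    exact Finset.sum_congr (by ext i; simp only [Finset.mem_Icc, Finset.mem_Ico]; omega) fun i hi => hai i (by simp at hi; omega)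
  have h4 := h1.trans h2
  rw [Finset.sum_range_succ'] at h4
  have h5 := whit_zero_le L
  rw [h3]
  have h6 : Nat.card {π : Equiv.Perm (Fin k) // Achievable t x π} ≤
    1 + ∑ i ∈ Finset.range n, whit L (i + 1) := by omega
  exact_mod_cast h6
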